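/- Let R be an associative ring with identity and let X be an object of D(R) such that for every s ∈ ℤ the module H^{-s}(X) is Gorenstein projective and for every B ∈ GP^⊥ the canonical map γ_s : Hom_{D(R)}(X, S(B)⟦s⟧) → Hom_R(H^{-s}(X), B) is bijective. Then there exists a cohomologically ghost distinguished triangle X → P → X' → X⟦1⟧ in D(R) in which P is a coproduct of shifts of stalk complexes of projective R-modules (in particular P ∈ ⟨P⟩₁), and such that for every s ∈ ℤ the module H^{-s}(X') is Gorenstein projective and for every projective R-module Q the canonical map γ_s : Hom_{D(R)}(X', S(Q)⟦s⟧) → Hom_R(H^{-s}(X'), Q) is bijective. (One-step coresolution construction in the proof of Proposition 3.2, direction (2) ⇒ (1).) -/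

import Mathlib

open CategoryTheory Limits DerivedCategory Pretriangulated

noncomputable section

universe w u

variable {R : Type u} [Ring R]

def Ext1Zero [HasExt.{w} (ModuleCat.{u} R)] (A B : ModuleCat.{u} R) : Prop :=
  Subsingleton (Abelian.Ext A B 1)

variable [HasDerivedCategory.{w} (ModuleCat.{u} R)]

def GhostTriangle {X Y Z : DerivedCategory (ModuleCat.{u} R)}
    (f : X ⟶ Y) (g : Y ⟶ Z) (h : Z ⟶ X⟦(1:ℤ)⟧) : Prop :=
  (Triangle.mk f g h ∈ distTriang (DerivedCategory (ModuleCat.{u} R))) ∧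
  ∀ s : ℤ,
    Function.Injective ((homologyFunctor (ModuleCat.{u} R) s).map f) ∧
    Function.Surjective ((homologyFunctor (ModuleCat.{u} R) s).map g) ∧
    Function.Exact ((homologyFunctor (ModuleCat.{u} R) s).map f)
      ((homologyFunctor (ModuleCat.{u} R) s).map g)

def stalk (M : ModuleCat.{u} R) : DerivedCategory (ModuleCat.{u} R) :=
  DerivedCategory.Q.obj
    ((HomologicalComplex.single (ModuleCat.{u} R) (ComplexShape.up ℤ) 0).obj M)

def stalkHomologyIso (M : ModuleCat.{u} R) :
    (homologyFunctor (ModuleCat.{u} R) 0).obj (stalk M) ≅ M :=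
  (homologyFunctorFactors (ModuleCat.{u} R) 0).app _ ≪≫
    (HomologicalComplex.homologyFunctorSingleIso (ModuleCat.{u} R) (ComplexShape.up ℤ) 0).app M

def shiftHomologyIso (X : DerivedCategory (ModuleCat.{u} R)) (s a a' : ℤ) (h : s + a = a') :
    (homologyFunctor (ModuleCat.{u} R) a).obj (X⟦s⟧) ≅
      (homologyFunctor (ModuleCat.{u} R) a').obj X :=
  ((homologyFunctor (ModuleCat.{u} R) 0).shiftIso s a a' h).app X

def gammaMap (X : DerivedCategory (ModuleCat.{u} R)) (M : ModuleCat.{u} R) (s : ℤ)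
    (f : X ⟶ (stalk M)⟦s⟧) : (homologyFunctor (ModuleCat.{u} R) (-s)).obj X ⟶ M :=
  (homologyFunctor (ModuleCat.{u} R) (-s)).map f ≫
    (shiftHomologyIso (stalk M) s (-s) 0 (by ring)).hom ≫ (stalkHomologyIso M).hom

def stalkCoproduct (J : Type u) (P : J → ModuleCat.{u} R) (n : J → ℤ) :
    DerivedCategory (ModuleCat.{u} R) :=
  DerivedCategory.Q.obj
    (∐ fun j => (((HomologicalComplex.single (ModuleCat.{u} R) (ComplexShape.up ℤ) 0).obj
      (P j))⟦n j⟧))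

def memP1 (E : DerivedCategory (ModuleCat.{u} R)) : Prop :=
  ∃ (J : Type u) (P : J → ModuleCat.{u} R) (n : J → ℤ),
    (∀ j, Projective (P j)) ∧
    ∃ (i : E ⟶ stalkCoproduct J P n) (r : stalkCoproduct J P n ⟶ E), i ≫ r = 𝟙 E

def IsGorensteinProjective (G : ModuleCat.{u} R) : Prop :=
  ∃ P : CochainComplex (ModuleCat.{u} R) ℤ,
    (∀ n : ℤ, Projective (P.X n)) ∧ (∀ n : ℤ, P.ExactAt n) ∧
    Nonempty (G ≅ P.cycles 0) ∧
    ∀ (Q : ModuleCat.{u} R), Projective Q → ∀ (n : ℤ) (f : P.X n ⟶ Q),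
      P.d (n-1) n ≫ f = 0 → ∃ g : P.X (n+1) ⟶ Q, f = P.d n (n+1) ≫ g

section Product

variable {C : Type*} [Category* C] [Preadditive C] {J : Type*}

/-- A family of cochain complexes, viewed as a complex of discrete diagrams. -/
def familyComplex (A : J → CochainComplex C ℤ) : CochainComplex (Discrete J ⥤ C) ℤ where
  X n := Discrete.functor fun j => (A j).X n
  d m n := Discrete.natTrans fun j => (A j.as).d m n
  shape m n h := by ext ⟨j⟩; simpa using (A j).shape m n h
  d_comp_d' _ _ _ _ _ := by ext ⟨j⟩; simp

/-- The morphism of complexes of discrete diagrams induced by a family of morphisms. -/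
def familyComplexMap {A B : J → CochainComplex C ℤ} (φ : ∀ j, A j ⟶ B j) :
    familyComplex A ⟶ familyComplex B where
  f n := Discrete.natTrans fun j => (φ j.as).f n
  comm' _ _ _ := by ext ⟨j⟩; simp [familyComplex]

lemma quasiIso_familyComplexMap {C : Type*} [Category* C] [Abelian C]
    {A B : J → CochainComplex C ℤ} (φ : ∀ j, A j ⟶ B j) [∀ j, QuasiIso (φ j)] :
    QuasiIso (familyComplexMap φ) := by
  rw [quasiIso_iff]
  intro n
  rw [quasiIsoAt_iff_isIso_homologyMap, NatTrans.isIso_iff_isIso_app]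
  rintro ⟨j⟩
  let F : (Discrete J ⥤ C) ⥤ C := (evaluation (Discrete J) C).obj ⟨j⟩
  have h : QuasiIsoAt ((F.mapHomologicalComplex (ComplexShape.up ℤ)).map
      (familyComplexMap φ)) n :=
    inferInstanceAs (QuasiIsoAt (φ j) n)
  rw [quasiIsoAt_iff_isIso_homologyMap] at h
  let α := (HomologicalComplex.shortComplexFunctor (Discrete J ⥤ C) (ComplexShape.up ℤ) n).map
    (familyComplexMap φ)
  have hα : IsIso (ShortComplex.homologyMap (F.mapShortComplex.map α)) := h
  have : IsIso (F.map (ShortComplex.homologyMap α)) := by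
    have e := ShortComplex.mapHomologyIso_hom_naturality F (φ := α)
    have := IsIso.comp_isIso' hα
      (Iso.isIso_hom (ShortComplex.mapHomologyIso ((familyComplex B).sc n) F))
    exact @IsIso.of_isIso_fac_left _ _ _ _ _ _ _ _
      (Iso.isIso_hom (ShortComplex.mapHomologyIso ((familyComplex A).sc n) F)) this e.symm
  exact this

variable [HasLimitsOfShape (Discrete J) C]

/-- The degreewise product of a family of cochain complexes. -/
def prodComplex (A : J → CochainComplex C ℤ) : CochainComplex C ℤ :=
  ((lim : (Discrete J ⥤ C) ⥤ C).mapHomologicalComplex (ComplexShape.up ℤ)).obj (familyComplex A)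

/-- The morphism between products induced by a family of morphisms. -/
def prodComplexMap {A B : J → CochainComplex C ℤ} (φ : ∀ j, A j ⟶ B j) :
    prodComplex A ⟶ prodComplex B :=
  ((lim : (Discrete J ⥤ C) ⥤ C).mapHomologicalComplex (ComplexShape.up ℤ)).map
    (familyComplexMap φ)

/-- The projection from the product onto one of its factors. -/
def prodComplexπ (A : J → CochainComplex C ℤ) (j : J) : prodComplex A ⟶ A j where
  f n := limit.π (Discrete.functor fun j => (A j).X n) ⟨j⟩
  comm' m n _ := (limMap_π (familyComplex A |>.d m n) _).symm

@[simp]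
lemma prodComplexMap_π {A B : J → CochainComplex C ℤ} (φ : ∀ j, A j ⟶ B j) (j : J) :
    prodComplexMap φ ≫ prodComplexπ B j = prodComplexπ A j ≫ φ j := by
  ext n
  exact limMap_π ((familyComplexMap φ).f n) _

lemma prodComplex_hom_ext {A : J → CochainComplex C ℤ} {n : ℤ} {Z : C}
    {f g : Z ⟶ (prodComplex A).X n}
    (h : ∀ j, f ≫ (prodComplexπ A j).f n = g ≫ (prodComplexπ A j).f n) : f = g :=
  limit.hom_ext fun ⟨j⟩ => h j

/-- The morphism to a component of the product induced by a family of morphisms. -/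
def prodComplexLiftX {A : J → CochainComplex C ℤ} {n : ℤ} {Z : C} (f : ∀ j, Z ⟶ (A j).X n) :
    Z ⟶ (prodComplex A).X n :=
  limit.lift (Discrete.functor fun j => (A j).X n) (Fan.mk Z f)

@[simp]
lemma prodComplexLiftX_π {A : J → CochainComplex C ℤ} {n : ℤ} {Z : C}
    (f : ∀ j, Z ⟶ (A j).X n) (j : J) : prodComplexLiftX f ≫ (prodComplexπ A j).f n = f j :=
  limit.lift_π (Fan.mk Z f) (Discrete.mk j)

/-- The morphism to the product induced by a family of morphisms. -/
def prodComplexLift {A : J → CochainComplex C ℤ} {K : CochainComplex C ℤ} (φ : ∀ j, K ⟶ A j) :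
    K ⟶ prodComplex A where
  f n := prodComplexLiftX fun j => (φ j).f n
  comm' m n _ := prodComplex_hom_ext fun j => by
    rw [Category.assoc, Category.assoc, ← (prodComplexπ A j).comm, ← Category.assoc,
      prodComplexLiftX_π, prodComplexLiftX_π, (φ j).comm]

@[simp]
lemma prodComplexLift_π {A : J → CochainComplex C ℤ} {K : CochainComplex C ℤ}
    (φ : ∀ j, K ⟶ A j) (j : J) : prodComplexLift φ ≫ prodComplexπ A j = φ j := by
  ext n
  simp [prodComplexLift]

end Product

lemma quasiIso_prodComplexMap {C : Type*} [Category* C] [Abelian C] {J : Type*}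
    [HasLimitsOfShape (Discrete J) C] [HasExactLimitsOfShape (Discrete J) C]
    {A B : J → CochainComplex C ℤ} (φ : ∀ j, A j ⟶ B j) [∀ j, QuasiIso (φ j)] :
    QuasiIso (prodComplexMap φ) := by
  have := quasiIso_familyComplexMap φ
  have : (lim : (Discrete J ⥤ C) ⥤ C).Additive := ⟨fun {_ _ f g} => limit.hom_ext fun j => by simp⟩
  exact HomologicalComplex.quasiIso_map_of_preservesHomology (familyComplexMap φ) lim

lemma exists_lift_prodComplex {C : Type*} [Category* C] [Abelian C] {J : Type*}
    [HasLimitsOfShape (Discrete J) C] [HasExactLimitsOfShape (Discrete J) C]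
    [HasDerivedCategory C] {A : J → CochainComplex C ℤ} {X : DerivedCategory C}
    (φ : ∀ j, X ⟶ Q.obj (A j)) :
    ∃ ψ : X ⟶ Q.obj (prodComplex A), ∀ j, ψ ≫ Q.map (prodComplexπ A j) = φ j := by
  let e := Q.objObjPreimageIso X
  choose Y g s hs hφ using fun j => left_fac (e.hom ≫ φ j)
  have (j : J) : QuasiIso (s j) := (isIso_Q_map_iff_quasiIso _ _).1 (hs j)
  have := quasiIso_prodComplexMap s
  refine ⟨e.inv ≫ Q.map (prodComplexLift g) ≫ inv (Q.map (prodComplexMap s)), fun j => ?_⟩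
  rw [← cancel_epi e.hom, ← cancel_mono (Q.map (s j)), hφ]
  have h : inv (Q.map (prodComplexMap s)) ≫ Q.map (prodComplexπ A j ≫ s j) =
      Q.map (prodComplexπ Y j) := by
    rw [IsIso.inv_comp_eq, ← Functor.map_comp, prodComplexMap_π]
  simp [h, ← Functor.map_comp]

section ZeroDifferential

variable {C : Type*} [Category* C] [Abelian C] {K L : CochainComplex C ℤ}

lemma isIso_homologyMap_of_d_eq_zero (hK : ∀ m n, K.d m n = 0) (hL : ∀ m n, L.d m n = 0)
    (f : K ⟶ L) (n : ℤ) [IsIso (f.f n)] : IsIso (HomologicalComplex.homologyMap f n) := by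
  have := K.isIso_iCycles n _ rfl (hK _ _)
  have := L.isIso_iCycles n _ rfl (hL _ _)
  have := K.isIso_homologyπ _ n rfl (hK _ _)
  have := L.isIso_homologyπ _ n rfl (hL _ _)
  have h₁ : IsIso (HomologicalComplex.cyclesMap f n) :=
    IsIso.of_isIso_fac_right (HomologicalComplex.cyclesMap_i f n)
  exact IsIso.of_isIso_fac_left (HomologicalComplex.homologyπ_naturality f n)

lemma f_eq_zero_of_homologyMap_eq_zero (hK : ∀ m n, K.d m n = 0) (hL : ∀ m n, L.d m n = 0)
    (f : K ⟶ L) (n : ℤ) (hf : HomologicalComplex.homologyMap f n = 0) : f.f n = 0 := by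
  have := K.isIso_iCycles n _ rfl (hK _ _)
  have := L.isIso_homologyπ _ n rfl (hL _ _)
  have h₁ : HomologicalComplex.cyclesMap f n = 0 := by
    rw [← cancel_mono (L.homologyπ n), ← HomologicalComplex.homologyπ_naturality, hf]
    simp
  rw [← cancel_epi (K.iCycles n), ← HomologicalComplex.cyclesMap_i, h₁]
  simp

lemma isKProjective_of_d_eq_zero (hK : ∀ m n, K.d m n = 0) [∀ n, Projective (K.X n)] :
    K.IsKProjective where
  nonempty_homotopy_zero {L} f hL := by
    have hf (m n : ℤ) (h : (ComplexShape.up ℤ).Rel m n) :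
        ∃ g : K.X n ⟶ L.X m, g ≫ L.d m n = f.f n := by
      have hE := (L.exactAt_iff' m n (n + 1) ((ComplexShape.up ℤ).prev_eq' h) (by simp)).1 (hL n)
      have h₀ : f.f n ≫ L.d n (n + 1) = 0 := by rw [f.comm, hK, zero_comp]
      exact ⟨hE.liftFromProjective (f.f n) h₀, hE.liftFromProjective_comp _ _⟩
    choose g hg using hf
    have : f = Homotopy.nullHomotopicMap' (fun i j h => g j i h) := by
      ext n
      rw [Homotopy.nullHomotopicMap'_f (k₀ := n + 1) (k₁ := n) (k₂ := n - 1) (by simp) (by simp),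
        hK, zero_comp, zero_add, hg]
    rw [this]
    exact ⟨Homotopy.nullHomotopy' _⟩

end ZeroDifferential

section Coproduct

variable {C : Type*} [Category* C] [Abelian C] {J : Type*}
  [HasColimitsOfShape (Discrete J) C]

lemma coproduct_X_hom_ext {A : J → CochainComplex C ℤ} {n : ℤ} {Z : C} {f g : (∐ A).X n ⟶ Z}
    (h : ∀ j, (Sigma.ι A j).f n ≫ f = (Sigma.ι A j).f n ≫ g) : f = g :=
  (isColimitOfPreserves (HomologicalComplex.eval C _ n) (coproductIsCoproduct A)).hom_ext
    fun ⟨j⟩ => h j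

open scoped Classical in
/-- The projection from a coproduct of cochain complexes onto one of its summands. -/
def coproductπ (A : J → CochainComplex C ℤ) (j : J) : ∐ A ⟶ A j :=
  Sigma.desc fun i => if h : i = j then eqToHom (by rw [h]) else 0

@[simp]
lemma ι_coproductπ (A : J → CochainComplex C ℤ) (j : J) :
    Sigma.ι A j ≫ coproductπ A j = 𝟙 _ := by
  simp [coproductπ]

variable {A : J → CochainComplex C ℤ} {e : J → ℤ} (he : Function.Injective e)
  (hA : ∀ j n, n ≠ e j → IsZero ((A j).X n))

include hA

omit [HasColimitsOfShape (Discrete J) C] in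
lemma d_eq_zero_of_concentrated (j : J) (m n : ℤ) : (A j).d m n = 0 := by
  by_cases hm : m = e j
  · by_cases hn : n = e j
    · exact (A j).shape _ _ (by simp; lia)
    · exact (hA j n hn).eq_of_tgt _ _
  · exact (hA j m hm).eq_of_src _ _

lemma coproduct_d_eq_zero (m n : ℤ) : (∐ A).d m n = 0 :=
  coproduct_X_hom_ext fun j => by
    rw [(Sigma.ι A j).comm, d_eq_zero_of_concentrated hA, zero_comp, comp_zero]

lemma isZero_coproduct_X {n : ℤ} (hn : ∀ j, n ≠ e j) : IsZero ((∐ A).X n) := by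
  rw [IsZero.iff_id_eq_zero]
  exact coproduct_X_hom_ext fun j => (hA j n (hn j)).eq_of_src _ _

include he

lemma isIso_coproduct_ι_f (j : J) : IsIso ((Sigma.ι A j).f (e j)) := by
  have : Epi ((Sigma.ι A j).f (e j)) := ⟨fun f g h => coproduct_X_hom_ext fun i => by
    obtain rfl | hij := eq_or_ne i j
    · exact h
    · exact (hA i _ (he.ne hij.symm)).eq_of_src _ _⟩
  have : IsSplitMono ((Sigma.ι A j).f (e j)) := ⟨⟨⟨(coproductπ A j).f (e j), by
    rw [← HomologicalComplex.comp_f, ι_coproductπ, HomologicalComplex.id_f]⟩⟩⟩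
  exact isIso_of_epi_of_isSplitMono _

lemma isIso_coproductπ_f (j : J) : IsIso ((coproductπ A j).f (e j)) := by
  have := isIso_coproduct_ι_f he hA j
  have h : (Sigma.ι A j).f (e j) ≫ (coproductπ A j).f (e j) = 𝟙 _ := by
    rw [← HomologicalComplex.comp_f, ι_coproductπ, HomologicalComplex.id_f]
  have : IsIso ((Sigma.ι A j).f (e j) ≫ (coproductπ A j).f (e j)) := by rw [h]; infer_instance
  exact IsIso.of_isIso_comp_left ((Sigma.ι A j).f (e j)) _

lemma projective_coproduct_X (hP : ∀ j, Projective ((A j).X (e j))) (n : ℤ) :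
    Projective ((∐ A).X n) := by
  by_cases hn : ∃ j, n = e j
  · obtain ⟨j, rfl⟩ := hn
    have := isIso_coproduct_ι_f he hA j
    exact Projective.of_iso (asIso ((Sigma.ι A j).f (e j))) (hP j)
  · push Not at hn
    exact Projective.of_iso (isZero_coproduct_X hA hn).isoZero.symm inferInstance

variable [HasLimitsOfShape (Discrete J) C]

lemma isIso_coproduct_to_prodComplex :
    IsIso (prodComplexLift (coproductπ A)) := by
  have (n : ℤ) : IsIso ((prodComplexLift (coproductπ A)).f n) := by
    by_cases hn : ∃ j, n = e j
    · obtain ⟨j, rfl⟩ := hn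
      have h : (prodComplexLift (coproductπ A)).f (e j) ≫ (prodComplexπ A j).f (e j) =
          (coproductπ A j).f (e j) := by
        rw [← HomologicalComplex.comp_f, prodComplexLift_π]
      have := isIso_coproductπ_f he hA j
      have : Mono ((prodComplexπ A j).f (e j)) := ⟨fun f g h => prodComplex_hom_ext fun i => by
        obtain rfl | hij := eq_or_ne i j
        · exact h
        · exact (hA i _ (he.ne hij.symm)).eq_of_tgt _ _⟩
      have : IsSplitEpi ((prodComplexπ A j).f (e j)) :=
        ⟨⟨⟨inv ((coproductπ A j).f (e j)) ≫ (prodComplexLift (coproductπ A)).f (e j), by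
          rw [Category.assoc, h, IsIso.inv_hom_id]⟩⟩⟩
      have := isIso_of_mono_of_isSplitEpi ((prodComplexπ A j).f (e j))
      exact IsIso.of_isIso_fac_right h
    · push Not at hn
      have h : IsZero ((prodComplex A).X n) := by
        rw [IsZero.iff_id_eq_zero]
        exact prodComplex_hom_ext fun j => (hA j n (hn j)).eq_of_tgt _ _
      exact (isZero_coproduct_X hA hn).isIso h _
  exact HomologicalComplex.Hom.isIso_of_components _

lemma exists_lift_coproduct [HasExactLimitsOfShape (Discrete J) C] [HasDerivedCategory C]
    {X : DerivedCategory C} (φ : ∀ j, X ⟶ Q.obj (A j)) :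
    ∃ ψ : X ⟶ Q.obj (∐ A), ∀ j, ψ ≫ Q.map (coproductπ A j) = φ j := by
  obtain ⟨ψ, hψ⟩ := exists_lift_prodComplex φ
  have := isIso_coproduct_to_prodComplex he hA
  refine ⟨ψ ≫ inv (Q.map (prodComplexLift (coproductπ A))), fun j => ?_⟩
  rw [← hψ, Category.assoc, ← prodComplexLift_π (coproductπ A) j, Q.map_comp,
    IsIso.inv_hom_id_assoc]

end Coproduct

lemma exists_Q_map_eq_of_isKProjective {C : Type*} [Category* C] [Abelian C]
    [HasDerivedCategory C] {K L : CochainComplex C ℤ} [K.IsKProjective] (f : Q.obj K ⟶ Q.obj L) :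
    ∃ g : K ⟶ L, Q.map g = f := by
  obtain ⟨g, hg⟩ := (CochainComplex.IsKProjective.Qh_map_bijective K _).surjective
    ((quotientCompQhIso C).hom.app K ≫ f ≫ (quotientCompQhIso C).inv.app L)
  obtain ⟨g, rfl⟩ := (HomotopyCategory.quotient _ _).map_surjective g
  refine ⟨g, ?_⟩
  rw [← cancel_epi ((quotientCompQhIso C).hom.app K), ← (quotientCompQhIso C).hom.naturality]
  simp [hg]

lemma iCycles_toCycles {C : Type*} [Category* C] [Abelian C] (T : CochainComplex C ℤ)
    (m n : ℤ) : T.iCycles m ≫ T.toCycles m n = 0 := by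
  simp [← cancel_mono (T.iCycles n)]

lemma shortExact_cycles {C : Type*} [Category* C] [Abelian C] (T : CochainComplex C ℤ)
    (hT : ∀ n, T.ExactAt n) (m n : ℤ) (h : m + 1 = n) :
    (ShortComplex.mk (T.iCycles m) (T.toCycles m n)
      (iCycles_toCycles T m n)).ShortExact where
  exact := ShortComplex.exact_of_f_is_kernel _
    (isKernelOfComp (T.iCycles n) (T.d m n) (T.cyclesIsKernel m n (by simpa using h))
      (iCycles_toCycles T m n) (by simp))
  epi_g := by
    obtain rfl := (ComplexShape.up ℤ).prev_eq' (show (ComplexShape.up ℤ).Rel m n from h)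
    exact (hT n).epi_toCycles

section GorensteinProjective

omit [HasDerivedCategory.{w} (ModuleCat.{u} R)]

lemma IsGorensteinProjective.of_iso {G G' : ModuleCat.{u} R} (e : G ≅ G')
    (hG : IsGorensteinProjective G) : IsGorensteinProjective G' := by
  obtain ⟨P, hP, hE, ⟨i⟩, h⟩ := hG
  exact ⟨P, hP, hE, ⟨e.symm ≪≫ i⟩, h⟩

lemma exists_extension_of_cycles {T : CochainComplex (ModuleCat.{u} R) ℤ}
    (hT : ∀ n, T.ExactAt n) {Q : ModuleCat.{u} R}
    (h : ∀ (n : ℤ) (f : T.X n ⟶ Q),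
      T.d (n-1) n ≫ f = 0 → ∃ g : T.X (n+1) ⟶ Q, f = T.d n (n+1) ≫ g)
    (n : ℤ) (φ : T.cycles n ⟶ Q) : ∃ ψ : T.X n ⟶ Q, T.iCycles n ≫ ψ = φ := by
  obtain ⟨m, rfl⟩ : ∃ m, n = m + 1 := ⟨n - 1, by simp⟩
  have := (shortExact_cycles T hT m (m + 1) rfl).epi_g
  dsimp at this
  obtain ⟨g, hg⟩ := h m (T.toCycles m (m + 1) ≫ φ) (by simp)
  exact ⟨g, by rw [← cancel_epi (T.toCycles m (m + 1)), hg]; simp⟩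

lemma isGorensteinProjective_cycles {T : CochainComplex (ModuleCat.{u} R) ℤ}
    (hP : ∀ n, Projective (T.X n)) (hT : ∀ n, T.ExactAt n)
    (h : ∀ (Q : ModuleCat.{u} R), Projective Q → ∀ (n : ℤ) (f : T.X n ⟶ Q),
      T.d (n-1) n ≫ f = 0 → ∃ g : T.X (n+1) ⟶ Q, f = T.d n (n+1) ≫ g) (k : ℤ) :
    IsGorensteinProjective (T.cycles k) := by
  refine ⟨T⟦k⟧, fun n => hP _, fun n => ?_, ⟨?_⟩, fun Q hQ n f hf => ?_⟩
  · rw [HomologicalComplex.exactAt_iff]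
    exact ShortComplex.exact_of_iso
      ((CochainComplex.shiftShortComplexFunctorIso _ k n (k + n) rfl).symm.app T) (hT _)
  · exact ShortComplex.cyclesMapIso
      ((CochainComplex.shiftShortComplexFunctorIso _ k 0 k (add_zero k)).symm.app T)
  · have key (a b c : ℤ) (hab : a + 1 = b) (hbc : b + 1 = c) (ε : ℤˣ) (f : T.X b ⟶ Q)
        (hf : (ε • T.d a b) ≫ f = 0) : ∃ g : T.X c ⟶ Q, f = (ε • T.d b c) ≫ g := by
      subst hbc
      obtain rfl : a = b - 1 := by lia
      rw [Linear.units_smul_comp, smul_eq_zero_iff_eq] at hf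
      obtain ⟨g, rfl⟩ := h Q hQ b f hf
      exact ⟨ε⁻¹ • g, by simp [smul_smul]⟩
    exact key (n - 1 + k) (n + k) (n + 1 + k) (by lia) (by lia) k.negOnePow f hf

lemma IsGorensteinProjective.exists_coresolution {G : ModuleCat.{u} R}
    (hG : IsGorensteinProjective G) :
    ∃ (P G' : ModuleCat.{u} R) (i : G ⟶ P) (q : P ⟶ G') (w : i ≫ q = 0),
      (ShortComplex.mk i q w).ShortExact ∧ Projective P ∧ IsGorensteinProjective G' ∧
      ∀ Q : ModuleCat.{u} R, Projective Q → ∀ φ : G ⟶ Q, ∃ ψ : P ⟶ Q, i ≫ ψ = φ := by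
  obtain ⟨T, hP, hT, ⟨e⟩, h⟩ := hG
  have hS := shortExact_cycles T hT 0 1 rfl
  refine ⟨T.X 0, T.cycles 1, e.hom ≫ T.iCycles 0, T.toCycles 0 1, by simp [iCycles_toCycles],
    ShortComplex.shortExact_of_iso ?_ hS, hP 0, isGorensteinProjective_cycles hP hT h 1,
    fun Q hQ φ => ?_⟩
  · exact ShortComplex.isoMk e.symm (Iso.refl _) (Iso.refl _)
  · obtain ⟨ψ, hψ⟩ := exists_extension_of_cycles hT (h Q hQ) 0 (e.inv ≫ φ)
    exact ⟨ψ, by simp [hψ]⟩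

lemma IsGorensteinProjective.ext1Zero [HasExt.{w} (ModuleCat.{u} R)] {G Q : ModuleCat.{u} R}
    (hG : IsGorensteinProjective G) [hQ : Projective Q] : Ext1Zero.{w} G Q := by
  obtain ⟨T, hP, hT, ⟨e⟩, h⟩ := hG
  have hS := shortExact_cycles T hT (-1) 0 rfl
  have := hP (-1)
  refine subsingleton_of_forall_eq 0 fun x => ?_
  suffices hx : (Abelian.Ext.mk₀ e.inv).comp x (zero_add 1) = 0 by
    have := congrArg (fun y => (Abelian.Ext.mk₀ e.hom).comp y (zero_add 1)) hx
    simpa using this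
  obtain ⟨y, hy⟩ := Abelian.Ext.contravariant_sequence_exact₃ hS Q
    ((Abelian.Ext.mk₀ e.inv).comp x (zero_add 1)) (Abelian.Ext.eq_zero_of_projective _)
    (add_zero 1)
  obtain ⟨φ, rfl⟩ := (Abelian.Ext.mk₀_bijective _ _).2 y
  obtain ⟨ψ, rfl⟩ := exists_extension_of_cycles hT (h Q hQ) (-1) φ
  rw [← hy, ← Abelian.Ext.mk₀_comp_mk₀]
  exact hS.extClass_comp_assoc _

end GorensteinProjective

section GammaMap

variable {X Y : DerivedCategory (ModuleCat.{u} R)} {M N : ModuleCat.{u} R} {s : ℤ}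

lemma gammaMap_comp (a : X ⟶ Y) (f : Y ⟶ (stalk M)⟦s⟧) :
    gammaMap X M s (a ≫ f) = (homologyFunctor _ (-s)).map a ≫ gammaMap Y M s f := by
  simp [gammaMap]

lemma gammaMap_eq_zero_iff (f : X ⟶ (stalk M)⟦s⟧) :
    gammaMap X M s f = 0 ↔ (homologyFunctor _ (-s)).map f = 0 := by
  rw [gammaMap, ← Category.assoc, Preadditive.IsIso.comp_right_eq_zero,
    Preadditive.IsIso.comp_right_eq_zero]

lemma gammaMap_sub (f g : X ⟶ (stalk M)⟦s⟧) :
    gammaMap X M s (f - g) = gammaMap X M s f - gammaMap X M s g := by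
  simp [gammaMap]

lemma gammaMap_zero : gammaMap X M s 0 = 0 := by simp [gammaMap]

lemma isIso_gammaMap (f : X ⟶ (stalk M)⟦s⟧) [IsIso ((homologyFunctor _ (-s)).map f)] :
    IsIso (gammaMap X M s f) := by
  unfold gammaMap; infer_instance

/-- The morphism of stalk complexes induced by a linear map. -/
def stalkMap (ψ : M ⟶ N) : stalk M ⟶ stalk N :=
  Q.map ((HomologicalComplex.single _ _ 0).map ψ)

lemma gammaMap_comp_stalkMap (f : X ⟶ (stalk M)⟦s⟧) (ψ : M ⟶ N) :
    gammaMap X N s (f ≫ (stalkMap ψ)⟦s⟧') = gammaMap X M s f ≫ ψ := by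
  have h₁ : (homologyFunctor _ (-s)).map ((stalkMap ψ)⟦s⟧') ≫
      (shiftHomologyIso (stalk N) s (-s) 0 (by ring)).hom =
      (shiftHomologyIso (stalk M) s (-s) 0 (by ring)).hom ≫
        (homologyFunctor _ 0).map (stalkMap ψ) :=
    ((homologyFunctor (ModuleCat.{u} R) 0).shiftIso s (-s) 0 (by ring)).hom.naturality _
  have h₂ : (homologyFunctor _ 0).map (stalkMap ψ) ≫ (stalkHomologyIso N).hom =
      (stalkHomologyIso M).hom ≫ ψ :=
    (Functor.isoWhiskerLeft (HomologicalComplex.single _ _ 0) (homologyFunctorFactors _ 0) ≪≫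
      HomologicalComplex.homologyFunctorSingleIso _ _ 0).hom.naturality ψ
  simp only [gammaMap, Functor.map_comp, Category.assoc]
  rw [reassoc_of% h₁, h₂]

end GammaMap

section StalkCoproduct

/-- The stalk complex of `M`, shifted by `n`. -/
abbrev shiftedSingle (M : ModuleCat.{u} R) (n : ℤ) : CochainComplex (ModuleCat.{u} R) ℤ :=
  ((HomologicalComplex.single (ModuleCat.{u} R) (ComplexShape.up ℤ) 0).obj M)⟦n⟧

omit [HasDerivedCategory.{w} (ModuleCat.{u} R)] in
lemma isZero_shiftedSingle_X (M : ModuleCat.{u} R) {m n : ℤ} (h : n ≠ -m) :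
    IsZero ((shiftedSingle M m).X n) :=
  HomologicalComplex.isZero_single_obj_X (ComplexShape.up ℤ) 0 M (n + m) (by lia)

omit [HasDerivedCategory.{w} (ModuleCat.{u} R)] in
lemma projective_shiftedSingle_X (M : ModuleCat.{u} R) [hM : Projective M] (m : ℤ) :
    Projective ((shiftedSingle M m).X (-m)) :=
  Projective.of_iso ((HomologicalComplex.singleObjXSelf (ComplexShape.up ℤ) 0 M).symm ≪≫
    HomologicalComplex.XIsoOfEq _ (show 0 = -m + m by lia)) hM

/-- Shifting a stalk complex commutes with passing to the derived category. -/
def shiftedSingleIso (M : ModuleCat.{u} R) (n : ℤ) :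
    Q.obj (shiftedSingle M n) ≅ (stalk M)⟦n⟧ :=
  (Q.commShiftIso n).app _

variable {J : Type u} (P : J → ModuleCat.{u} R) {m : J → ℤ}

/-- The defining presentation of `stalkCoproduct`. -/
def stalkCoproductIso (m : J → ℤ) :
    stalkCoproduct J P m ≅ Q.obj (∐ fun j => shiftedSingle (P j) (m j)) :=
  Iso.refl _

/-- The projection from `stalkCoproduct` onto a shifted stalk. -/
def stalkCoproductπ (m : J → ℤ) (j : J) : stalkCoproduct J P m ⟶ (stalk (P j))⟦m j⟧ :=
  (stalkCoproductIso P m).hom ≫ Q.map (coproductπ (fun j => shiftedSingle (P j) (m j)) j) ≫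
    (shiftedSingleIso (P j) (m j)).hom

variable (hm : Function.Injective m)

include hm

lemma exists_lift_stalkCoproduct {X : DerivedCategory (ModuleCat.{u} R)}
    (φ : ∀ j, X ⟶ (stalk (P j))⟦m j⟧) :
    ∃ ψ : X ⟶ stalkCoproduct J P m, ∀ j, ψ ≫ stalkCoproductπ P m j = φ j := by
  obtain ⟨ψ, hψ⟩ := exists_lift_coproduct (neg_injective.comp hm)
    (A := fun j => shiftedSingle (P j) (m j)) (fun j n => isZero_shiftedSingle_X (P j))
    (fun j => φ j ≫ (shiftedSingleIso (P j) (m j)).inv)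
  refine ⟨ψ ≫ (stalkCoproductIso P m).inv, fun j => ?_⟩
  simp only [stalkCoproductπ, Category.assoc, Iso.inv_hom_id_assoc]
  rw [reassoc_of% (hψ j), Iso.inv_hom_id, Category.comp_id]

lemma isIso_gammaMap_stalkCoproductπ (j : J) :
    IsIso (gammaMap _ _ _ (stalkCoproductπ P m j)) := by
  have hA : ∀ j n, n ≠ -m j → IsZero ((shiftedSingle (P j) (m j)).X n) :=
    fun j n => isZero_shiftedSingle_X (P j)
  have : IsIso ((coproductπ (fun j => shiftedSingle (P j) (m j)) j).f (-m j)) :=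
    isIso_coproductπ_f (neg_injective.comp hm) hA j
  have := isIso_homologyMap_of_d_eq_zero (coproduct_d_eq_zero hA)
    (d_eq_zero_of_concentrated hA j) (coproductπ _ j) (-m j)
  have : IsIso ((homologyFunctor _ (-m j)).map
      (Q.map (coproductπ (fun j => shiftedSingle (P j) (m j)) j))) :=
    (NatIso.isIso_map_iff (homologyFunctorFactors _ (-m j)) _).2 this
  have : IsIso ((homologyFunctor _ (-m j)).map (stalkCoproductπ P m j)) := by
    rw [stalkCoproductπ, Functor.map_comp, Functor.map_comp]
    infer_instance
  exact isIso_gammaMap _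

lemma injective_gammaMap_stalkCoproduct (hP : ∀ j, Projective (P j)) (M : ModuleCat.{u} R)
    (s : ℤ) : Function.Injective (gammaMap (stalkCoproduct J P m) M s) := by
  intro p q hpq
  rw [← sub_eq_zero, ← gammaMap_sub, gammaMap_eq_zero_iff] at hpq
  rw [← sub_eq_zero]
  generalize p - q = p at hpq
  let A := fun j => shiftedSingle (P j) (m j)
  have hA : ∀ j n, n ≠ -m j → IsZero ((A j).X n) :=
    fun j n => isZero_shiftedSingle_X (P j)
  have hM : ∀ (_ : Unit) n, n ≠ -s → IsZero ((shiftedSingle M s).X n) :=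
    fun _ n => isZero_shiftedSingle_X M
  have := projective_coproduct_X (neg_injective.comp hm) hA
    (fun j => projective_shiftedSingle_X (P j) (m j))
  have := isKProjective_of_d_eq_zero (coproduct_d_eq_zero hA)
  obtain ⟨p₀, hp₀⟩ := exists_Q_map_eq_of_isKProjective (K := ∐ A)
    ((stalkCoproductIso P m).inv ≫ p ≫ (shiftedSingleIso M s).inv)
  have h₀ : HomologicalComplex.homologyMap p₀ (-s) = 0 := by
    have := homologyFunctorFactors_hom_naturality p₀ (-s)
    rw [hp₀, Functor.map_comp, Functor.map_comp, hpq, zero_comp, comp_zero, zero_comp] at this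
    exact (cancel_epi ((homologyFunctorFactors _ (-s)).app (∐ A)).hom).1
      (this.symm.trans comp_zero.symm)
  have h₁ : p₀ = 0 := by
    refine HomologicalComplex.hom_ext _ _ fun n => ?_
    by_cases hn : n = -s
    · subst hn
      exact f_eq_zero_of_homologyMap_eq_zero (coproduct_d_eq_zero hA)
        (d_eq_zero_of_concentrated hM ()) _ _ h₀
    · exact (isZero_shiftedSingle_X M hn).eq_of_tgt _ _
  rwa [h₁, Functor.map_zero, eq_comm, Preadditive.IsIso.comp_left_eq_zero,
    Preadditive.IsIso.comp_right_eq_zero] at hp₀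

omit hm in
lemma surjective_gammaMap_of_isIso {X : DerivedCategory (ModuleCat.{u} R)} {N : ModuleCat.{u} R}
    {s : ℤ} (f : X ⟶ (stalk N)⟦s⟧) [IsIso (gammaMap X N s f)] (M : ModuleCat.{u} R) :
    Function.Surjective (gammaMap X M s) := fun φ =>
  ⟨f ≫ (stalkMap (inv (gammaMap X N s f) ≫ φ))⟦s⟧', by simp [gammaMap_comp_stalkMap]⟩

lemma bijective_gammaMap_stalkCoproduct (hP : ∀ j, Projective (P j)) (M : ModuleCat.{u} R)
    (j : J) : Function.Bijective (gammaMap (stalkCoproduct J P m) M (m j)) := by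
  have := isIso_gammaMap_stalkCoproductπ P hm j
  exact ⟨injective_gammaMap_stalkCoproduct P hm hP M _,
    surjective_gammaMap_of_isIso (stalkCoproductπ P m j) M⟩

end StalkCoproduct

section Triangle

variable {X Y Z : DerivedCategory (ModuleCat.{u} R)} {f : X ⟶ Y} {g : Y ⟶ Z} {h : Z ⟶ X⟦(1 : ℤ)⟧}
  (hT : Triangle.mk f g h ∈ distTriang (DerivedCategory (ModuleCat.{u} R)))

include hT

lemma epi_homologyMap_of_mono (n : ℤ) (hf : Mono ((homologyFunctor _ (n + 1)).map f)) :
    Epi ((homologyFunctor _ n).map g) :=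
  (HomologySequence.epi_homologyMap_mor₂_iff _ hT n (n + 1)).2
    ((HomologySequence.mono_homologyMap_mor₁_iff _ hT n (n + 1)).1 hf)

lemma ghostTriangle_of_mono (hf : ∀ n : ℤ, Mono ((homologyFunctor _ n).map f)) :
    GhostTriangle f g h :=
  ⟨hT, fun n => ⟨(ModuleCat.mono_iff_injective _).1 (hf n),
    (ModuleCat.epi_iff_surjective _).1 (epi_homologyMap_of_mono hT n (hf _)),
    (ShortComplex.ShortExact.moduleCat_exact_iff_function_exact _).1
      (HomologySequence.exact₂ _ hT n)⟩⟩

/-- If the cohomology of the first morphism of a distinguished triangle is the first map of a short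
exact sequence, then the cohomology of its third object is the cokernel. -/
lemma nonempty_homology_obj₃_iso (n : ℤ) (hg : Epi ((homologyFunctor _ n).map g))
    {G P C : ModuleCat.{u} R} {i : G ⟶ P} {q : P ⟶ C} {w : i ≫ q = 0}
    (hS : (ShortComplex.mk i q w).ShortExact)
    (e₁ : (homologyFunctor _ n).obj X ≅ G) (e₂ : (homologyFunctor _ n).obj Y ≅ P)
    (comm : (homologyFunctor _ n).map f ≫ e₂.hom = e₁.hom ≫ i) :
    Nonempty ((homologyFunctor _ n).obj Z ≅ C) := by
  have := hS.epi_g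
  have hE : (ShortComplex.mk ((homologyFunctor _ n).map f) ((homologyFunctor _ n).map g) _).Exact :=
    HomologySequence.exact₂ _ hT n
  exact ⟨hE.gIsCokernel.coconePointUniqueUpToIso (cokernelIsCokernel _) ≪≫
    cokernel.mapIso _ _ e₁ e₂ comm ≪≫
    (cokernelIsCokernel _).coconePointUniqueUpToIso hS.exact.gIsCokernel⟩

lemma eq_zero_of_mor₂_comp_eq_zero {W : DerivedCategory (ModuleCat.{u} R)} (s : ℤ)
    (hW : ∀ v : X ⟶ W⟦s - 1⟧, ∃ p : Y ⟶ W⟦s - 1⟧, f ≫ p = v)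
    (q : Z ⟶ W⟦s⟧) (hq : g ≫ q = 0) : q = 0 := by
  obtain ⟨t, rfl⟩ : ∃ t : X⟦(1 : ℤ)⟧ ⟶ W⟦s⟧, q = h ≫ t := Triangle.yoneda_exact₃ _ hT q hq
  let e : W⟦s⟧ ≅ (W⟦s - 1⟧)⟦(1 : ℤ)⟧ :=
    (shiftFunctorAdd' _ (s - 1) 1 s (by simp)).app W
  obtain ⟨v, hv⟩ := (shiftFunctor (DerivedCategory (ModuleCat.{u} R)) (1 : ℤ)).map_surjective
    (t ≫ e.hom)
  obtain ⟨p, rfl⟩ := hW v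
  have hf : h ≫ f⟦(1 : ℤ)⟧' = 0 := comp_distTriang_mor_zero₃₁ _ hT
  rw [← cancel_mono e.hom, Category.assoc, ← hv, Functor.map_comp, reassoc_of% hf, zero_comp,
    zero_comp]

end Triangle

theorem stmt17 [HasExt.{w} (ModuleCat.{u} R)]
    (X : DerivedCategory (ModuleCat.{u} R))
    (hGP : ∀ s : ℤ, IsGorensteinProjective ((homologyFunctor (ModuleCat.{u} R) (-s)).obj X))
    (hgamma : ∀ N : ModuleCat.{u} R,
      (∀ G : ModuleCat.{u} R, IsGorensteinProjective G → Ext1Zero G N) →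
      ∀ s : ℤ, Function.Bijective (gammaMap X N s)) :
    ∃ (J : Type u) (P : J → ModuleCat.{u} R) (m : J → ℤ),
      (∀ j, Projective (P j)) ∧
      ∃ (X' : DerivedCategory (ModuleCat.{u} R))
        (f : X ⟶ stalkCoproduct J P m) (g : stalkCoproduct J P m ⟶ X')
        (h : X' ⟶ X⟦(1:ℤ)⟧),
        GhostTriangle f g h ∧
        (∀ s : ℤ, IsGorensteinProjective ((homologyFunctor (ModuleCat.{u} R) (-s)).obj X')) ∧
        ∀ Q : ModuleCat.{u} R, Projective Q →
          ∀ s : ℤ, Function.Bijective (gammaMap X' Q s) := by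
  have hX (Q : ModuleCat.{u} R) (hQ : Projective Q) (s : ℤ) :
      Function.Bijective (gammaMap X Q s) := hgamma Q (fun G hG => hG.ext1Zero) s
  choose P C i q w hS hP hC hext using fun s => (hGP s).exists_coresolution
  choose φ hφ using fun s => (hX (P s) (hP s) s).surjective (i s)
  let P' : ULift.{u} ℤ → ModuleCat.{u} R := fun j => P j.down
  let m : ULift.{u} ℤ → ℤ := fun j => j.down
  have hm : Function.Injective m := ULift.down_injective
  have hP' : ∀ j, Projective (P' j) := fun j => hP j.down
  obtain ⟨f, hf⟩ := exists_lift_stalkCoproduct P' hm (fun j => φ j.down)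
  have hγ (M : ModuleCat.{u} R) (s : ℤ) :
      Function.Bijective (gammaMap (stalkCoproduct _ P' m) M s) :=
    bijective_gammaMap_stalkCoproduct P' hm hP' M ⟨s⟩
  let c (s : ℤ) : (homologyFunctor _ (-s)).obj (stalkCoproduct _ P' m) ⟶ P s :=
    gammaMap _ _ _ (stalkCoproductπ P' m ⟨s⟩)
  have hc (s : ℤ) : IsIso (c s) := isIso_gammaMap_stalkCoproductπ P' hm ⟨s⟩
  have hfc (s : ℤ) : (homologyFunctor _ (-s)).map f ≫ c s = i s :=
    (gammaMap_comp f _).symm.trans ((congrArg _ (hf ⟨s⟩)).trans (hφ s))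
  have hlift (Q : ModuleCat.{u} R) (hQ : Projective Q) (s : ℤ) (a : X ⟶ (stalk Q)⟦s⟧) :
      ∃ p : stalkCoproduct _ P' m ⟶ (stalk Q)⟦s⟧, f ≫ p = a := by
    obtain ⟨ψ, hψ⟩ := hext s Q hQ (gammaMap X Q s a)
    obtain ⟨p, hp⟩ := (hγ Q s).surjective (c s ≫ ψ)
    exact ⟨p, (hX Q hQ s).injective (by rw [gammaMap_comp, hp, reassoc_of% (hfc s), hψ])⟩
  have hmono (n : ℤ) : Mono ((homologyFunctor _ n).map f) := by
    obtain ⟨s, rfl⟩ := neg_surjective n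
    have : Mono (i s) := (hS s).mono_f
    exact mono_of_mono_fac (hfc s)
  obtain ⟨X', g, h, hT⟩ := distinguished_cocone_triangle f
  have hepi (n : ℤ) : Epi ((homologyFunctor _ n).map g) :=
    epi_homologyMap_of_mono hT n (hmono _)
  refine ⟨_, P', m, hP', X', f, g, h, ghostTriangle_of_mono hT hmono, fun s => ?_,
    fun Q hQ s => ⟨fun a b hab => ?_, fun χ => ?_⟩⟩
  · have := hc s
    obtain ⟨e⟩ := nonempty_homology_obj₃_iso hT (-s) (hepi _) (hS s) (Iso.refl _) (asIso (c s))
      ((hfc s).trans (Category.id_comp _).symm)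
    exact (hC s).of_iso e.symm
  · rw [← sub_eq_zero] at hab ⊢
    rw [← gammaMap_sub] at hab
    refine eq_zero_of_mor₂_comp_eq_zero hT s (hlift Q hQ (s - 1)) _ ((hγ Q s).injective ?_)
    rw [gammaMap_comp, hab, gammaMap_zero, comp_zero]
  · obtain ⟨p, hp⟩ := (hγ Q s).surjective ((homologyFunctor _ (-s)).map g ≫ χ)
    have hfg : f ≫ g = 0 := comp_distTriang_mor_zero₁₂ _ hT
    have hfp : f ≫ p = 0 := (hX Q hQ s).injective (by
      rw [gammaMap_comp, hp, ← Functor.map_comp_assoc, hfg, gammaMap_zero, Functor.map_zero,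
        zero_comp])
    obtain ⟨r, rfl⟩ : ∃ r : X' ⟶ (stalk Q)⟦s⟧, p = g ≫ r := Triangle.yoneda_exact₂ _ hT p hfp
    have := hepi (-s)
    exact ⟨r, (cancel_epi ((homologyFunctor _ (-s)).map g)).1 (by rw [← gammaMap_comp, hp])⟩
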